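/- arXiv:1509.02591 — 3 statements merged into one kernel-verified Lean document; each statement's English description precedes it below -/
import Mathlib

section
/- For X = [0,1] with its usual metric, the map i : C([0,1]) → C²([0,1]) sending a continuum A (a closed subinterval of [0,1]) to the set i(A) of all its subcontinua is continuous, where C([0,1]) carries the Hausdorff metric dist_H and its double hyperspace carries the induced Hausdorff metric dist_{H²}. -/
open Metric Set Filter TopologicalSpace

/-- The hyperspace of continua (nonempty compact connected subsets) of `X`,
with the Hausdorff distance as its metric. -/
abbrev Continua (X : Type*) [MetricSpace X] :=
  {K : TopologicalSpace.NonemptyCompacts X // IsConnected (K : Set X)}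

/-- i(A): the set of subcontinua of A, as a subset of the hyperspace. -/
def iSet {X : Type*} [MetricSpace X] (A : Continua X) : Set (Continua X) :=
  {B | (B.1 : Set X) ⊆ (A.1 : Set X)}

lemma exists_continuous_metric_retraction (B : Continua unitInterval) :
    ∃ r : unitInterval → unitInterval, Continuous r ∧ (∀ x, r x ∈ (B.1 : Set unitInterval)) ∧
      ∀ x, ∀ y ∈ (B.1 : Set unitInterval), dist x (r x) ≤ dist x y := by
  have hB := eq_Icc_of_connected_compact B.2 B.1.isCompact
  set c := sInf (B.1 : Set unitInterval)
  set d := sSup (B.1 : Set unitInterval)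
  have hcd : c ≤ d := nonempty_Icc.1 (hB ▸ B.1.nonempty)
  refine ⟨fun x ↦ max c (min d x), by fun_prop, fun x ↦ ?_, fun x y hy ↦ ?_⟩
  · rw [hB]
    exact ⟨le_max_left _ _, max_le hcd (min_le_left _ _)⟩
  · beta_reduce
    rw [hB] at hy
    obtain ⟨hcy, hyd⟩ := hy
    rcases le_total x c with hxc | hcx
    · rw [min_eq_right (hxc.trans hcd), max_eq_left hxc]
      simp only [Subtype.dist_eq, Real.dist_eq, ← Subtype.coe_le_coe] at *
      rw [abs_of_nonpos (by linarith), abs_of_nonpos (by linarith)]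
      linarith
    · rcases le_total x d with hxd | hdx
      · rw [min_eq_right hxd, max_eq_right hcx, dist_self]
        exact dist_nonneg
      · rw [min_eq_left hdx, max_eq_right hcd]
        simp only [Subtype.dist_eq, Real.dist_eq, ← Subtype.coe_le_coe] at *
        rw [abs_of_nonneg (by linarith), abs_of_nonneg (by linarith)]
        linarith

lemma exists_mem_iSet_dist_le {A B : Continua unitInterval} {δ : ℝ} (h : dist A B < δ)
    {K : Continua unitInterval} (hK : K ∈ iSet A) : ∃ L ∈ iSet B, dist K L ≤ δ := by
  obtain ⟨r, hr, hrB, hrd⟩ := exists_continuous_metric_retraction B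
  have hdist : ∀ x ∈ (K.1 : Set unitInterval), dist x (r x) ≤ δ := by
    intro x hx
    obtain ⟨y, hy, hxy⟩ := exists_dist_lt_of_hausdorffDist_lt (hK hx) h
      (hausdorffEDist_ne_top_of_nonempty_of_bounded A.1.nonempty B.1.nonempty
        A.1.isCompact.isBounded B.1.isCompact.isBounded)
    exact (hrd x y hy).trans hxy.le
  refine ⟨⟨K.1.map r hr, ?_⟩, ?_, ?_⟩
  · rw [NonemptyCompacts.coe_map]
    exact K.2.image r hr.continuousOn
  · change ((K.1.map r hr : NonemptyCompacts unitInterval) : Set unitInterval) ⊆ _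
    rw [NonemptyCompacts.coe_map]
    rintro _ ⟨x, -, rfl⟩
    exact hrB x
  · change hausdorffDist (K.1 : Set unitInterval)
      ((K.1.map r hr : NonemptyCompacts unitInterval) : Set unitInterval) ≤ δ
    rw [NonemptyCompacts.coe_map]
    refine hausdorffDist_le_of_mem_dist (dist_nonneg.trans h.le)
      (fun x hx ↦ ⟨r x, mem_image_of_mem r hx, hdist x hx⟩) ?_
    rintro _ ⟨x, hx, rfl⟩
    exact ⟨x, hx, dist_comm x (r x) ▸ hdist x hx⟩

/-- For X = [0,1], the map i : C([0,1]) → C²([0,1]), A ↦ {subcontinua of A}, is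
continuous from the Hausdorff metric dist_H to the induced Hausdorff metric
dist_{H²} on the double hyperspace. -/
theorem iSet_continuous_unitInterval :
    ∀ A : Continua unitInterval, ∀ ε > (0:ℝ), ∃ δ > (0:ℝ),
      ∀ B : Continua unitInterval, dist A B < δ →
        hausdorffDist (iSet A) (iSet B) < ε := by
  intro A ε hε
  refine ⟨ε / 2, half_pos hε, fun B hAB ↦ lt_of_le_of_lt ?_ (half_lt_self hε)⟩
  exact hausdorffDist_le_of_mem_dist (half_pos hε).le
    (fun _ hK ↦ exists_mem_iSet_dist_le hAB hK)
    (fun _ hK ↦ exists_mem_iSet_dist_le (dist_comm A B ▸ hAB) hK)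
end

section
/- Let X = [0,1] × [0,1] with the Euclidean metric. There exist a continuum A ⊆ X, a sequence of continua (A_n) in X, and a constant c > 0 such that dist_H(A_n, A) → 0 as n → ∞ while dist_{H²}(i(A_n), i(A)) ≥ c for all n. In particular, the map i : C(X) → C²(X), A ↦ {subcontinua of A}, is not continuous on the square. -/
open Metric Set Filter TopologicalSpace

/-- The unit square. -/
abbrev Sq : Type := unitInterval × unitInterval

/-- The comb with base `[0,1] × {0}` and a vertical tooth over each point of `T`. -/
def combSet (T : Set unitInterval) : Set Sq :=
  {p | p.2 = 0 ∨ p.1 ∈ T}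

lemma isClosed_combSet {T : Set unitInterval} (hT : T.Finite) : IsClosed (combSet T) :=
  (isClosed_eq continuous_snd continuous_const).union (hT.isClosed.preimage continuous_fst)

lemma isConnected_combSet (T : Set unitInterval) : IsConnected (combSet T) := by
  refine ⟨⟨(0, 0), Or.inl rfl⟩, ?_⟩
  have hbase : IsPreconnected (univ ×ˢ {0} : Set Sq) :=
    isPreconnected_univ.prod isPreconnected_singleton
  have hbase_sub : (univ ×ˢ {0} : Set Sq) ⊆ combSet T := fun p hp => Or.inl hp.2
  refine isPreconnected_of_forall ((0, 0) : Sq) ?_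
  rintro ⟨x, y⟩ (hy | hx)
  · exact ⟨univ ×ˢ {0}, hbase_sub, ⟨trivial, rfl⟩, ⟨trivial, hy⟩, hbase⟩
  · have htooth : IsPreconnected ({x} ×ˢ univ : Set Sq) :=
      isPreconnected_singleton.prod isPreconnected_univ
    refine ⟨univ ×ˢ {0} ∪ {x} ×ˢ univ, union_subset hbase_sub ?_, Or.inl ⟨trivial, rfl⟩,
      Or.inr ⟨rfl, trivial⟩, hbase.union (x, 0) ⟨trivial, rfl⟩ ⟨rfl, trivial⟩ htooth⟩
    rintro ⟨a, b⟩ ⟨rfl, -⟩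
    exact Or.inr hx

/-- The comb over a finite set, as a continuum of the square. -/
def comb (T : Set unitInterval) (hT : T.Finite) : Continua Sq :=
  ⟨⟨⟨combSet T, (isClosed_combSet hT).isCompact⟩, (isConnected_combSet T).nonempty⟩,
    isConnected_combSet T⟩

/-- The whole square, as a continuum. -/
def fullSquare : Continua Sq :=
  ⟨⟨⟨univ, isCompact_univ⟩, univ_nonempty⟩, isConnected_univ⟩

/-- The top edge of the square, as a continuum. -/
def topEdge : Continua Sq :=
  ⟨⟨⟨univ ×ˢ {1}, isCompact_univ.prod isCompact_singleton⟩, ⟨(0, 1), trivial, rfl⟩⟩,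
    isConnected_univ.prod isConnected_singleton⟩

lemma dist_continua_eq {X : Type*} [MetricSpace X] (A B : Continua X) :
    dist A B = hausdorffDist (A.1 : Set X) (B.1 : Set X) := rfl

lemma hausdorffEDist_continua_ne_top {X : Type*} [MetricSpace X] (A B : Continua X) :
    hausdorffEDist (A.1 : Set X) (B.1 : Set X) ≠ ⊤ :=
  hausdorffEDist_ne_top_of_nonempty_of_bounded A.2.nonempty B.2.nonempty
    A.1.isCompact.isBounded B.1.isCompact.isBounded

lemma hausdorffEDist_iSet_ne_top {X : Type*} [MetricSpace X] [CompactSpace X]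
    (A B : Continua X) : hausdorffEDist (iSet A) (iSet B) ≠ ⊤ :=
  hausdorffEDist_ne_top_of_nonempty_of_bounded ⟨A, Subset.rfl⟩ ⟨B, Subset.rfl⟩
    (Bornology.IsBounded.all _) (Bornology.IsBounded.all _)

lemma dist_comb_fullSquare_le {T : Set unitInterval} (hT : T.Finite) {ε : ℝ} (hε : 0 < ε)
    (hcover : ∀ x, ∃ t ∈ T, dist x t < ε) : dist (comb T hT) fullSquare ≤ ε := by
  rw [dist_continua_eq]
  refine hausdorffDist_le_of_mem_dist hε.le (fun p _ => ⟨p, trivial, by simpa using hε.le⟩) ?_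
  rintro ⟨x, y⟩ -
  obtain ⟨t, ht, hxt⟩ := hcover x
  exact ⟨(t, y), Or.inr ht, by simpa using hxt.le⟩

lemma quarter_le_dist_topEdge_of_mem_iSet_comb {T : Set unitInterval} (hT : T.Finite)
    {C : Continua Sq} (hC : C ∈ iSet (comb T hT)) : 1 / 4 ≤ dist C topEdge := by
  by_contra! hlt
  rw [dist_continua_eq] at hlt
  have hfin := hausdorffEDist_continua_ne_top C topEdge
  have hfst : ∀ p ∈ (C.1 : Set Sq), p.1 ∈ T := by
    intro p hp
    obtain ⟨q, hq, hpq⟩ := exists_dist_lt_of_hausdorffDist_lt hp hlt hfin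
    refine (hC hp).resolve_left fun h0 => ?_
    have hq1 : q.2 = 1 := hq.2
    have := (le_max_right (dist p.1 q.1) (dist p.2 q.2)).trans_lt hpq
    rw [h0, hq1, Subtype.dist_eq, Real.dist_eq] at this
    norm_num at this
  have hsub : (Prod.fst '' (C.1 : Set Sq)).Subsingleton :=
    hT.countable.isTotallyDisconnected _ (image_subset_iff.2 hfst)
      (C.2.isPreconnected.image _ continuous_fst.continuousOn)
  obtain ⟨p, hp, hp0⟩ := exists_dist_lt_of_hausdorffDist_lt'
    (show ((0, 1) : Sq) ∈ (topEdge.1 : Set Sq) from ⟨trivial, rfl⟩) hlt hfin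
  obtain ⟨q, hq, hq1⟩ := exists_dist_lt_of_hausdorffDist_lt'
    (show ((1, 1) : Sq) ∈ (topEdge.1 : Set Sq) from ⟨trivial, rfl⟩) hlt hfin
  have hpq : p.1 = q.1 := hsub (mem_image_of_mem _ hp) (mem_image_of_mem _ hq)
  have h0 : dist p.1 0 < 1 / 4 := (le_max_left _ _).trans_lt hp0
  have h1 : dist q.1 1 < 1 / 4 := (le_max_left _ _).trans_lt hq1
  rw [Subtype.dist_eq, Real.dist_eq, abs_lt] at h0 h1
  rw [hpq] at h0
  norm_num at h0 h1
  linarith [h0.2, h1.1]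

lemma quarter_le_hausdorffDist_iSet_comb {T : Set unitInterval} (hT : T.Finite) :
    1 / 4 ≤ hausdorffDist (iSet (comb T hT)) (iSet fullSquare) := by
  by_contra! hlt
  obtain ⟨C, hC, hdist⟩ := exists_dist_lt_of_hausdorffDist_lt'
    (show topEdge ∈ iSet fullSquare from subset_univ _) hlt (hausdorffEDist_iSet_ne_top _ _)
  exact hdist.not_ge (quarter_le_dist_topEdge_of_mem_iSet_comb hT hC)

lemma exists_comb_near_fullSquare {ε : ℝ} (hε : 0 < ε) :
    ∃ (T : Set unitInterval) (hT : T.Finite), dist (comb T hT) fullSquare ≤ ε := by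
  obtain ⟨T, -, hT, hcover⟩ :=
    (isCompact_univ (X := unitInterval)).finite_cover_balls hε
  refine ⟨T, hT, dist_comb_fullSquare_le hT hε fun x => ?_⟩
  simpa using hcover (mem_univ x)

/-- On the square X = [0,1] × [0,1] there are a continuum A, a sequence of continua
(A_n) and a constant c > 0 with dist_H(A_n, A) → 0 while
dist_{H²}(i(A_n), i(A)) ≥ c for all n; in particular the map i : C(X) → C²(X) is
not continuous on the square. -/
theorem iSet_not_continuous_on_square :
    ∃ (A : Continua Sq) (Aseq : ℕ → Continua Sq) (c : ℝ), 0 < c ∧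
      Tendsto (fun n : ℕ => dist (Aseq n) A) atTop (nhds 0) ∧
      ∀ n : ℕ, c ≤ hausdorffDist (iSet (Aseq n)) (iSet A) := by
  choose T hT hdist using fun n : ℕ => exists_comb_near_fullSquare (Nat.one_div_pos_of_nat (n := n))
  exact ⟨fullSquare, fun n => comb (T n) (hT n), 1 / 4, by norm_num,
    squeeze_zero (fun _ => dist_nonneg) hdist tendsto_one_div_add_atTop_nhds_zero_nat,
    fun n => quarter_le_hausdorffDist_iSet_comb (hT n)⟩
end

section
/- Let S¹ = ℝ/ℤ with its quotient metric and quotient map q : ℝ → S¹, let s = q(0), and for n ≥ 2 let A_n = q([0, 1 - 1/n]) be the arc of length 1 - 1/n starting at s. Then, in the double hyperspace of S¹, i(A_n) converges as n → ∞ to the marked hypercircle S¹_s = {A ∈ C(S¹) : s is not in the interior of A}, i.e. dist_{H²}(i(A_n), S¹_s) → 0. In particular, since A_n → S¹ in dist_H but i(A_n) does not converge to i(S¹), the map i is not continuous on C(S¹). -/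
open Metric Set Filter TopologicalSpace

instance : Fact ((0:ℝ) < 1) := ⟨zero_lt_one⟩

/-- The circle S¹ = ℝ/ℤ with its quotient metric. -/
abbrev S1 : Type := AddCircle (1:ℝ)

/-- The quotient map q : ℝ → S¹. -/
noncomputable def q (t : ℝ) : S1 := (t : S1)

lemma q_continuous : Continuous q := continuous_quotient_mk'

lemma one_sub_inv_nonneg (n : ℕ) : (0:ℝ) ≤ 1 - 1/(n:ℝ) := by
  rcases Nat.eq_zero_or_pos n with h | h
  · simp [h]
  · have h1 : (1:ℝ) ≤ (n:ℝ) := by exact_mod_cast h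
    have : 1/(n:ℝ) ≤ 1 := by rw [div_le_one (by linarith)]; exact h1
    linarith

/-- The arc A_n = q([0, 1 - 1/n]) of length 1 - 1/n starting at s = q(0),
as an element of the hyperspace. -/
noncomputable def arcC (n : ℕ) : Continua S1 :=
  ⟨⟨⟨q '' Icc 0 (1 - 1/(n:ℝ)), isCompact_Icc.image q_continuous⟩,
    (nonempty_Icc.2 (one_sub_inv_nonneg n)).image q⟩,
    (isConnected_Icc (one_sub_inv_nonneg n)).image q q_continuous.continuousOn⟩

/-- The marked hypercircle S¹_s for s = q(0): the continua of S¹ not containing s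
in their interior. -/
noncomputable def markedHypercircle : Set (Continua S1) :=
  {A | q 0 ∉ interior (A.1 : Set S1)}

/-- The whole circle as an element of the hyperspace. -/
noncomputable def wholeS1 : Continua S1 :=
  ⟨⟨⟨univ, isCompact_univ⟩, univ_nonempty⟩, isConnected_univ⟩

lemma q_eq_q_iff {u v : ℝ} : q u = q v ↔ ∃ m : ℤ, u - v = m := by
  unfold q
  rw [← sub_eq_zero, ← AddCircle.coe_sub, AddCircle.coe_eq_zero_iff]
  simp [eq_comm]

lemma dist_q_le (u v : ℝ) : dist (q u) (q v) ≤ |u - v| := by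
  unfold q
  rw [dist_eq_norm, ← AddCircle.coe_sub, AddCircle.norm_eq]
  simpa using round_le (u - v) 0

lemma exists_int_abs_sub_lt {u v ε : ℝ} (h : dist (q u) (q v) < ε) :
    ∃ m : ℤ, |u - v - m| < ε := by
  unfold q at h
  rw [dist_eq_norm, ← AddCircle.coe_sub, AddCircle.norm_eq] at h
  exact ⟨round (u - v), by simpa using h⟩

/-- The lift of the circle to the fundamental domain `[a, a + 1)`. -/
noncomputable def liftIco (a : ℝ) (x : S1) : ℝ := AddCircle.equivIco 1 a x

lemma liftIco_mem (a : ℝ) (x : S1) : liftIco a x ∈ Ico a (a + 1) :=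
  (AddCircle.equivIco 1 a x).2

lemma q_liftIco (a : ℝ) (x : S1) : q (liftIco a x) = x :=
  (AddCircle.equivIco 1 a).symm_apply_apply x

lemma continuousOn_liftIco {a : ℝ} {K : Set S1} (ha : q a ∉ K) :
    ContinuousOn (liftIco a) K := fun x hx =>
  (continuous_subtype_val.continuousAt.comp
    (AddCircle.continuousAt_equivIco 1 a fun h => ha (by
      rw [h] at hx; exact hx))).continuousWithinAt

lemma exists_lift_near_zero_notMem {K : Set S1} (hK : q 0 ∉ interior K) {ε : ℝ} (hε : 0 < ε) :
    ∃ a : ℝ, |a| < ε ∧ q a ∉ K := by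
  by_contra! h
  refine hK (mem_interior_iff_mem_nhds.2 (Metric.mem_nhds_iff.2 ⟨ε, hε, fun x hx => ?_⟩))
  rw [← q_liftIco 0 x, Metric.mem_ball] at hx
  obtain ⟨m, hm⟩ := exists_int_abs_sub_lt hx
  have := h _ hm
  rwa [q_eq_q_iff.2 ⟨-m, by push_cast; ring⟩, q_liftIco] at this

lemma q_neg_notMem_arcC {n : ℕ} {δ : ℝ} (h0 : 0 < δ) (h1 : δ < 1 / (n : ℝ)) :
    q (-δ) ∉ ((arcC n).1 : Set S1) := by
  rintro ⟨t, ⟨ht0, ht1⟩, h⟩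
  obtain ⟨m, hm⟩ := q_eq_q_iff.1 h
  have hm0 : (0 : ℝ) < m := by linarith
  have hm1 : (m : ℝ) < 1 := by linarith
  norm_cast at hm0 hm1
  omega

lemma iSet_arcC_subset_markedHypercircle {n : ℕ} (hn : 0 < n) :
    iSet (arcC n) ⊆ markedHypercircle := by
  intro B hB h0
  have h := q_continuous.continuousAt.preimage_mem_nhds (mem_interior_iff_mem_nhds.1 h0)
  obtain ⟨ε, hε, hball⟩ := Metric.mem_nhds_iff.1 h
  have hn' : (0 : ℝ) < 1 / (n : ℝ) := by positivity
  obtain ⟨δ, hδ0, hδ⟩ := exists_between (lt_min hε hn')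
  rw [lt_min_iff] at hδ
  refine q_neg_notMem_arcC hδ0 hδ.2 (hB (hball ?_))
  simpa [abs_of_pos hδ0] using hδ.1

/-- The affine map sending `[a, a + 1]` onto `[0, 1 - 1 / n]`, read on the circle cut at `q a`. -/
noncomputable def squash (n : ℕ) (a : ℝ) (x : S1) : S1 :=
  q ((liftIco a x - a) * (1 - 1 / (n : ℝ)))

lemma continuousOn_squash (n : ℕ) {a : ℝ} {K : Set S1} (ha : q a ∉ K) :
    ContinuousOn (squash n a) K :=
  q_continuous.comp_continuousOn
    (((continuousOn_liftIco ha).sub continuousOn_const).mul continuousOn_const)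

lemma squash_mem_arcC (n : ℕ) (a : ℝ) (x : S1) : squash n a x ∈ ((arcC n).1 : Set S1) := by
  have h := liftIco_mem a x
  have hn := one_sub_inv_nonneg n
  exact ⟨_, ⟨mul_nonneg (by linarith [h.1]) hn,
    mul_le_of_le_one_left hn (by linarith [h.2])⟩, rfl⟩

lemma dist_squash_le (n : ℕ) (a : ℝ) (x : S1) :
    dist x (squash n a x) ≤ |a| + 1 / (n : ℝ) := by
  have h := liftIco_mem a x
  have hn : (0 : ℝ) ≤ 1 / (n : ℝ) := by positivity
  calc dist x (squash n a x) = dist (q (liftIco a x)) (squash n a x) := by rw [q_liftIco]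
    _ ≤ |liftIco a x - (liftIco a x - a) * (1 - 1 / (n : ℝ))| := dist_q_le _ _
    _ = |a + (liftIco a x - a) * (1 / (n : ℝ))| := by ring_nf
    _ ≤ |a| + |(liftIco a x - a) * (1 / (n : ℝ))| := abs_add_le _ _
    _ ≤ |a| + 1 / (n : ℝ) := by
      rw [abs_of_nonneg (mul_nonneg (by linarith [h.1]) hn)]
      gcongr
      exact mul_le_of_le_one_left hn (by linarith [h.2])

lemma exists_mem_iSet_arcC_dist_le {A : Continua S1} (hA : A ∈ markedHypercircle) {n : ℕ}
    (hn : 0 < n) : ∃ B ∈ iSet (arcC n), dist A B ≤ 2 / (n : ℝ) := by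
  have hn' : (0 : ℝ) < 1 / (n : ℝ) := by positivity
  obtain ⟨a, ha, haA⟩ := exists_lift_near_zero_notMem hA hn'
  have hc := continuousOn_squash n haA
  have hd (x : S1) : dist x (squash n a x) ≤ 2 / (n : ℝ) :=
    (dist_squash_le n a x).trans (by rw [show 2 / (n : ℝ) = 1 / n + 1 / n by ring]; linarith)
  refine ⟨⟨⟨⟨squash n a '' A.1, A.1.isCompact.image_of_continuousOn hc⟩,
    A.1.nonempty.image _⟩, A.2.image _ hc⟩, ?_, ?_⟩
  · rintro _ ⟨x, -, rfl⟩
    exact squash_mem_arcC n a x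
  · refine hausdorffDist_le_of_mem_dist (by positivity)
      (fun x hx => ⟨_, mem_image_of_mem _ hx, hd x⟩) ?_
    rintro _ ⟨x, hx, rfl⟩
    exact ⟨x, hx, by rw [dist_comm]; exact hd x⟩

lemma isBounded_continua {X : Type*} [MetricSpace X] [CompactSpace X] (S : Set (Continua X)) :
    Bornology.IsBounded S := by
  obtain ⟨C, hC⟩ := Metric.isBounded_iff.1
    (isCompact_univ (X := NonemptyCompacts X)).isBounded
  exact Metric.isBounded_iff.2 ⟨C, fun A _ B _ => hC (mem_univ A.1) (mem_univ B.1)⟩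

/-- The arc `q([-1/4, 1/4])`, a continuum with `q 0` in its interior. -/
noncomputable def centredArc : Continua S1 :=
  ⟨⟨⟨q '' Icc (-1 / 4) (1 / 4), isCompact_Icc.image q_continuous⟩,
    (nonempty_Icc.2 (by norm_num)).image q⟩,
    (isConnected_Icc (by norm_num)).image q q_continuous.continuousOn⟩

lemma le_dist_centredArc {n : ℕ} (hn : 4 ≤ n) {B : Continua S1} (hB : B ∈ iSet (arcC n)) :
    1 / 8 ≤ dist B centredArc := by
  by_contra! h
  have hn' : (4 : ℝ) ≤ n := by exact_mod_cast hn
  have hpos : (0 : ℝ) < 1 / (n : ℝ) := by positivity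
  have hle : 1 / (n : ℝ) ≤ 1 / 4 := by gcongr
  set δ : ℝ := 1 / (n : ℝ) / 2 with hδ
  have hcut : q (-δ) ∉ (B.1 : Set S1) := fun hx =>
    q_neg_notMem_arcC (by linarith) (by linarith) (hB hx)
  have htop : hausdorffEDist (B.1 : Set S1) (centredArc.1 : Set S1) ≠ ⊤ :=
    hausdorffEDist_ne_top_of_nonempty_of_bounded B.1.nonempty centredArc.1.nonempty
      B.1.isCompact.isBounded centredArc.1.isCompact.isBounded
  have key (v : ℝ) (hv : v ∈ Icc (-1 / 4 : ℝ) (1 / 4)) :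
      ∃ x ∈ (B.1 : Set S1), ∃ m : ℤ, |liftIco (-δ) x - v - m| < 1 / 8 := by
    obtain ⟨x, hx, hxv⟩ := exists_dist_lt_of_hausdorffDist_lt' (mem_image_of_mem q hv) h htop
    rw [← q_liftIco (-δ) x] at hxv
    exact ⟨x, hx, exists_int_abs_sub_lt hxv⟩
  obtain ⟨x, hx, m, hm⟩ := key (1 / 4) (by norm_num)
  obtain ⟨y, hy, k, hk⟩ := key (-1 / 4) (by norm_num)
  have hx' := liftIco_mem (-δ) x
  have hy' := liftIco_mem (-δ) y
  rw [abs_lt] at hm hk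
  have hx2 : liftIco (-δ) x ≤ 1 / 2 := by
    have : (m : ℝ) < 1 := by linarith [hx'.2]
    have : m ≤ 0 := by norm_cast at this; omega
    have : (m : ℝ) ≤ 0 := by exact_mod_cast this
    linarith
  have hy2 : 1 / 2 ≤ liftIco (-δ) y := by
    have : (0 : ℝ) < k := by linarith [hy'.1]
    have : 1 ≤ k := by norm_cast at this
    have : (1 : ℝ) ≤ k := by exact_mod_cast this
    linarith
  obtain ⟨z, hz, hz2⟩ := B.2.isPreconnected.intermediate_value hx hy
    (continuousOn_liftIco hcut) ⟨hx2, hy2⟩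
  obtain ⟨_, ⟨c, hc, rfl⟩, hzc⟩ := exists_dist_lt_of_hausdorffDist_lt hz h htop
  rw [← q_liftIco (-δ) z, hz2] at hzc
  obtain ⟨j, hj⟩ := exists_int_abs_sub_lt hzc
  rw [abs_lt] at hj
  have h0 : (0 : ℝ) < j := by linarith [hc.2]
  have h1 : (j : ℝ) < 1 := by linarith [hc.1]
  norm_cast at h0 h1
  omega


/-- In the double hyperspace of S¹, i(A_n) converges to the marked hypercircle
S¹_s, i.e. dist_{H²}(i(A_n), S¹_s) → 0; moreover A_n → S¹ in dist_H while
i(A_n) does not converge to i(S¹), so i is not continuous on C(S¹). -/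
theorem iSet_arc_tendsto_markedHypercircle :
    Tendsto (fun n : ℕ => hausdorffDist (iSet (arcC n)) markedHypercircle)
        atTop (nhds 0) ∧
      Tendsto (fun n : ℕ => hausdorffDist ((arcC n).1 : Set S1) ((wholeS1).1 : Set S1))
        atTop (nhds 0) ∧
      ¬ Tendsto (fun n : ℕ => hausdorffDist (iSet (arcC n)) (iSet wholeS1))
        atTop (nhds 0) := by
  refine ⟨?_, ?_, fun h => ?_⟩
  · refine squeeze_zero' (Eventually.of_forall fun _ => hausdorffDist_nonneg) ?_
      (tendsto_const_div_atTop_nhds_zero_nat 2)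
    filter_upwards [eventually_gt_atTop 0] with n hn
    refine hausdorffDist_le_of_mem_dist (by positivity) (fun B hB => ?_)
      fun A hA => exists_mem_iSet_arcC_dist_le hA hn
    exact ⟨B, iSet_arcC_subset_markedHypercircle hn hB, by rw [dist_self]; positivity⟩
  · refine squeeze_zero (fun _ => hausdorffDist_nonneg) (fun n => ?_)
      tendsto_one_div_atTop_nhds_zero_nat
    refine hausdorffDist_le_of_mem_dist (by positivity)
      (fun x _ => ⟨x, mem_univ x, by rw [dist_self]; positivity⟩)
      fun x _ => ⟨squash n 0 x, squash_mem_arcC n 0 x, ?_⟩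
    simpa using dist_squash_le n 0 x
  · obtain ⟨n, hlt, hn⟩ := ((h.eventually (gt_mem_nhds (by norm_num : (0 : ℝ) < 1 / 8))).and
      (eventually_ge_atTop 4)).exists
    have htop : hausdorffEDist (iSet (arcC n)) (iSet wholeS1) ≠ ⊤ :=
      hausdorffEDist_ne_top_of_nonempty_of_bounded ⟨arcC n, Subset.rfl⟩
        ⟨wholeS1, Subset.rfl⟩ (isBounded_continua _) (isBounded_continua _)
    have hmem : centredArc ∈ iSet wholeS1 := subset_univ _
    obtain ⟨B, hB, hd⟩ := exists_dist_lt_of_hausdorffDist_lt' hmem hlt htop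
    exact absurd hd (not_lt.2 (le_dist_centredArc hn hB))
end
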